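/- arXiv:math-ph/0305048 — 6 statements merged into one kernel-verified Lean document; each statement's English description precedes it below -/
import Mathlib

section
/- The hyperbolic volume measure μ on the upper half-space, defined as Lebesgue measure on ℝ² × (0,∞) with density 1/y³ (coordinates (x₀, x₁, y)), is preserved by each of the three maps (x₀, x₁, y) ↦ (x₀ + 1, x₁, y), (x₀, x₁, y) ↦ (x₀, x₁ + 1, y), and (x₀, x₁, y) ↦ (-x₀/N, x₁/N, y/N) where N = x₀² + x₁² + y². (These are the generators z ↦ z+1, z ↦ z+i, z ↦ -z⁻¹ of the Picard group acting on the upper half-space.) -/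
open MeasureTheory

/-- The hyperbolic volume measure `dμ = dx₀ dx₁ dy / y³` on the upper half-space,
identified with `ℝ² × (0,∞)` with coordinates `(x₀, x₁, y)`. -/
noncomputable def hypMeasure : Measure (ℝ × ℝ × ℝ) :=
  (volume.restrict {p : ℝ × ℝ × ℝ | 0 < p.2.2}).withDensity
    fun p => ENNReal.ofReal (1 / p.2.2 ^ 3)

open Set

/-- Change of variables: a bijection of `H` whose Jacobian compensates the density `w` preserves
the measure with density `w` on `H`. -/
theorem measurePreserving_withDensity_of_bijOn {E : Type*} [NormedAddCommGroup E]
    [NormedSpace ℝ E] [FiniteDimensional ℝ E] [MeasurableSpace E] [BorelSpace E]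
    (μ : Measure E) [μ.IsAddHaarMeasure] {H : Set E} (hH : MeasurableSet H)
    {w : E → ENNReal} {f : E → E} {f' : E → E →L[ℝ] E} (hf : Measurable f)
    (hbij : BijOn f H H) (hf' : ∀ x ∈ H, HasFDerivAt f (f' x) x)
    (hw : ∀ x ∈ H, ENNReal.ofReal |(f' x).det| * w (f x) = w x) :
    MeasurePreserving f ((μ.restrict H).withDensity w) ((μ.restrict H).withDensity w) := by
  refine ⟨hf, Measure.ext fun s hs => ?_⟩
  have hT : MeasurableSet (f ⁻¹' s ∩ H) := (hf hs).inter hH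
  have himage : f '' (f ⁻¹' s ∩ H) = s ∩ H := by
    rw [image_preimage_inter, hbij.image_eq]
  rw [Measure.map_apply hf hs, withDensity_apply _ (hf hs), withDensity_apply _ hs,
    Measure.restrict_restrict (hf hs), Measure.restrict_restrict hs, ← himage,
    lintegral_image_eq_lintegral_abs_det_fderiv_mul μ hT
      (fun x hx => (hf' x hx.2).hasFDerivWithinAt) (hbij.injOn.mono inter_subset_right)]
  exact setLIntegral_congr_fun hT fun x hx => (hw x hx.2).symm

/-- The determinant of an endomorphism of `R × R × R` in terms of the standard basis. -/
theorem LinearMap.det_prod_prod {R : Type*} [CommRing R] (f : R × R × R →ₗ[R] R × R × R) :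
    LinearMap.det f =
      !![(f (1, 0, 0)).1, (f (0, 1, 0)).1, (f (0, 0, 1)).1;
         (f (1, 0, 0)).2.1, (f (0, 1, 0)).2.1, (f (0, 0, 1)).2.1;
         (f (1, 0, 0)).2.2, (f (0, 1, 0)).2.2, (f (0, 0, 1)).2.2].det := by
  let e : (R × R × R) ≃ₗ[R] (Fin 3 → R) :=
    { toFun := fun p => ![p.1, p.2.1, p.2.2]
      invFun := fun v => (v 0, v 1, v 2)
      map_add' := fun p q => by ext i; fin_cases i <;> rfl
      map_smul' := fun c p => by ext i; fin_cases i <;> rfl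
      left_inv := fun p => rfl
      right_inv := fun v => by ext i; fin_cases i <;> rfl }
  have he : ∀ p, e p = ![p.1, p.2.1, p.2.2] := fun _ => rfl
  have hsymm : ∀ v, e.symm v = (v 0, v 1, v 2) := fun _ => rfl
  rw [← LinearMap.det_toMatrix (Module.Basis.ofEquivFun e)]
  congr 1
  ext i j
  fin_cases i <;> fin_cases j <;> simp [LinearMap.toMatrix_apply, he, hsymm]

theorem measurableSet_upperHalfSpace : MeasurableSet {p : ℝ × ℝ × ℝ | 0 < p.2.2} :=
  measurableSet_lt measurable_const (measurable_snd.comp measurable_snd)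

instance : (volume : Measure (ℝ × ℝ × ℝ)).IsAddHaarMeasure :=
  have : (volume : Measure (ℝ × ℝ)).IsAddHaarMeasure := Measure.prod.instIsAddHaarMeasure _ _
  Measure.prod.instIsAddHaarMeasure _ _

/-- Horizontal translations preserve the hyperbolic measure. -/
theorem measurePreserving_add_horizontal (a b : ℝ) :
    MeasurePreserving (fun p : ℝ × ℝ × ℝ => p + (a, b, 0)) hypMeasure hypMeasure := by
  refine measurePreserving_withDensity_of_bijOn (f' := fun _ => .id ℝ _) volume
    measurableSet_upperHalfSpace (measurable_add_const _)
    ⟨fun p hp => by simpa using hp, (add_left_injective _).injOn,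
      fun p hp => ⟨p - (a, b, 0), by simpa using hp, by simp⟩⟩
    (fun p _ => (hasFDerivAt_id p).add_const _) fun p _ => ?_
  simp [ContinuousLinearMap.det]

/-- The map `z ↦ -z⁻¹` of the upper half-space, in coordinates. -/
noncomputable def negInv (p : ℝ × ℝ × ℝ) : ℝ × ℝ × ℝ :=
  (-p.1 / (p.1 ^ 2 + p.2.1 ^ 2 + p.2.2 ^ 2),
    p.2.1 / (p.1 ^ 2 + p.2.1 ^ 2 + p.2.2 ^ 2),
    p.2.2 / (p.1 ^ 2 + p.2.1 ^ 2 + p.2.2 ^ 2))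

theorem negInv_negInv {p : ℝ × ℝ × ℝ} (hp : p.1 ^ 2 + p.2.1 ^ 2 + p.2.2 ^ 2 ≠ 0) :
    negInv (negInv p) = p := by
  obtain ⟨a, b, c⟩ := p
  simp only at hp
  have hN : (-a / (a ^ 2 + b ^ 2 + c ^ 2)) ^ 2 + (b / (a ^ 2 + b ^ 2 + c ^ 2)) ^ 2 +
      (c / (a ^ 2 + b ^ 2 + c ^ 2)) ^ 2 = (a ^ 2 + b ^ 2 + c ^ 2)⁻¹ := by
    field_simp
  simp only [negInv, hN]
  ext <;> field_simp

theorem exists_hasFDerivAt_negInv {p : ℝ × ℝ × ℝ}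
    (hp : p.1 ^ 2 + p.2.1 ^ 2 + p.2.2 ^ 2 ≠ 0) :
    ∃ f' : (ℝ × ℝ × ℝ) →L[ℝ] (ℝ × ℝ × ℝ), HasFDerivAt negInv f' p ∧
      f'.det = 1 / (p.1 ^ 2 + p.2.1 ^ 2 + p.2.2 ^ 2) ^ 3 := by
  have h₀ : HasFDerivAt (fun q : ℝ × ℝ × ℝ => q.1) (.fst ℝ ℝ (ℝ × ℝ)) p := hasFDerivAt_fst
  have h₁ : HasFDerivAt (fun q : ℝ × ℝ × ℝ => q.2.1) (.comp (.fst ℝ ℝ ℝ) (.snd ℝ ℝ (ℝ × ℝ))) p :=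
    hasFDerivAt_snd.fst
  have h₂ : HasFDerivAt (fun q : ℝ × ℝ × ℝ => q.2.2) (.comp (.snd ℝ ℝ ℝ) (.snd ℝ ℝ (ℝ × ℝ))) p :=
    hasFDerivAt_snd.snd
  have hN := HasDerivAt.comp_hasFDerivAt p
    (f := fun q : ℝ × ℝ × ℝ => q.1 ^ 2 + q.2.1 ^ 2 + q.2.2 ^ 2) (hasDerivAt_inv hp)
    (((h₀.pow 2).fun_add (h₁.pow 2)).fun_add (h₂.pow 2))
  refine ⟨_, (h₀.fun_neg.mul hN).prodMk ((h₁.mul hN).prodMk (h₂.mul hN)), ?_⟩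
  rw [ContinuousLinearMap.det, LinearMap.det_prod_prod, Matrix.det_fin_three]
  obtain ⟨a, b, c⟩ := p
  simp only at hp
  simp
  field_simp
  ring

theorem measurePreserving_negInv : MeasurePreserving negInv hypMeasure hypMeasure := by
  have hN : ∀ p ∈ {p : ℝ × ℝ × ℝ | 0 < p.2.2}, 0 < p.1 ^ 2 + p.2.1 ^ 2 + p.2.2 ^ 2 :=
    fun p (hp : 0 < p.2.2) => by positivity
  have hmaps : MapsTo negInv {p | 0 < p.2.2} {p | 0 < p.2.2} :=
    fun p hp => div_pos hp (hN p hp)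
  have hinv : LeftInvOn negInv negInv {p | 0 < p.2.2} :=
    fun p hp => negInv_negInv (hN p hp).ne'
  choose! f' hf' hdet using fun p (hp : p ∈ {p : ℝ × ℝ × ℝ | 0 < p.2.2}) =>
    exists_hasFDerivAt_negInv (hN p hp).ne'
  refine measurePreserving_withDensity_of_bijOn volume measurableSet_upperHalfSpace
    (by unfold negInv; fun_prop) (InvOn.bijOn ⟨hinv, hinv⟩ hmaps hmaps) hf' fun p hp => ?_
  have hNp := hN p hp
  rw [hdet p hp, abs_of_pos (by positivity), ← ENNReal.ofReal_mul (by positivity)]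
  have hy : p.2.2 ≠ 0 := ne_of_gt hp
  congr 1
  simp only [negInv]
  field_simp


/-- The hyperbolic volume measure on the upper half-space is preserved by the three
generators of the Picard group: `z ↦ z + 1`, `z ↦ z + i`, and `z ↦ -z⁻¹`, which in
coordinates `(x₀, x₁, y)` are the maps `(x₀+1, x₁, y)`, `(x₀, x₁+1, y)` and
`(-x₀/N, x₁/N, y/N)` with `N = x₀² + x₁² + y²`. -/
theorem picard_generators_measure_preserving :
    MeasurePreserving (fun p : ℝ × ℝ × ℝ => (p.1 + 1, p.2.1, p.2.2))
      hypMeasure hypMeasure ∧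
    MeasurePreserving (fun p : ℝ × ℝ × ℝ => (p.1, p.2.1 + 1, p.2.2))
      hypMeasure hypMeasure ∧
    MeasurePreserving (fun p : ℝ × ℝ × ℝ =>
        (-p.1 / (p.1 ^ 2 + p.2.1 ^ 2 + p.2.2 ^ 2),
          p.2.1 / (p.1 ^ 2 + p.2.1 ^ 2 + p.2.2 ^ 2),
          p.2.2 / (p.1 ^ 2 + p.2.1 ^ 2 + p.2.2 ^ 2)))
      hypMeasure hypMeasure := by
  refine ⟨?_, ?_, measurePreserving_negInv⟩
  · convert measurePreserving_add_horizontal 1 0 using 2 with p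
    ext <;> simp
  · convert measurePreserving_add_horizontal 0 1 using 2 with p
    ext <;> simp
end

section
/- For every complex number s with Re s > 1, the Dedekind zeta function of the number field ℚ(i) satisfies ζ_{ℚ(i)}(s) = (1/4) · Σ_{ν ∈ ℤ[i], ν ≠ 0} (ν·conj(ν))⁻ˢ, where the absolutely convergent sum runs over all nonzero Gaussian integers ν and ν·conj(ν) is the norm of ν. -/
open GaussianInt

namespace GaussianInt

/-- The imaginary unit as a unit of `ℤ[i]`. -/
def unitI : GaussianIntˣ :=
  ⟨⟨0, 1⟩, ⟨0, -1⟩, by decide, by decide⟩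

theorem card_units : Nat.card GaussianIntˣ = 4 := by
  have hbij : Function.Bijective fun k : Fin 4 ↦ unitI ^ k.val := by
    refine ⟨by decide, fun u ↦ ?_⟩
    have hnorm : u.val.re * u.val.re + u.val.im * u.val.im = 1 := by
      have := (Zsqrtd.norm_eq_one_iff' (d := -1) (by norm_num) u.val).2 u.isUnit
      rw [Zsqrtd.norm_def] at this
      linarith
    have hval : ∀ k : Fin 4, unitI.val ^ k.val = u.val → ∃ k : Fin 4, unitI ^ k.val = u :=
      fun k hk ↦ ⟨k, Units.ext (by simpa using hk)⟩
    have hre : u.val.re ≤ 1 := by nlinarith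
    have hre' : -1 ≤ u.val.re := by nlinarith
    have him : u.val.im ≤ 1 := by nlinarith
    have him' : -1 ≤ u.val.im := by nlinarith
    obtain ⟨⟨a, b⟩, v, huv, hvu⟩ := u
    simp only at hnorm hre hre' him him' hval
    interval_cases a <;> interval_cases b <;> first
      | omega
      | exact hval 0 (by decide)
      | exact hval 1 (by decide)
      | exact hval 2 (by decide)
      | exact hval 3 (by decide)
  simpa using (Nat.card_eq_of_bijective _ hbij).symm

/-- The coordinates of a Gaussian integer with respect to `1, i`. -/
def coordEquiv : GaussianInt ≃ₗ[ℤ] (Fin 2 → ℤ) where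
  toFun z := ![z.re, z.im]
  invFun v := ⟨v 0, v 1⟩
  map_add' x y := by simp
  map_smul' n x := by simp
  left_inv x := rfl
  right_inv v := by ext k; fin_cases k <;> rfl

theorem coordEquiv_apply (z : GaussianInt) : coordEquiv z = ![z.re, z.im] := rfl

theorem coordEquiv_symm_apply (v : Fin 2 → ℤ) : coordEquiv.symm v = ⟨v 0, v 1⟩ := rfl

/-- The `ℤ`-basis `1, i` of `ℤ[i]`. -/
noncomputable def integralBasis : Module.Basis (Fin 2) ℤ GaussianInt :=
  .ofEquivFun coordEquiv

theorem algebraNorm_eq_norm (z : GaussianInt) : Algebra.norm ℤ z = z.norm := by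
  rw [Algebra.norm_eq_matrix_det integralBasis, Matrix.det_fin_two]
  simp [Algebra.leftMulMatrix_eq_repr_mul, integralBasis, coordEquiv_apply,
    coordEquiv_symm_apply, Zsqrtd.norm_def]

theorem card_quotient_span_singleton (z : GaussianInt) :
    (Nat.card (GaussianInt ⧸ Ideal.span {z}) : ℤ) = (z * star z).re := by
  have : Module.Free ℤ GaussianInt := .of_basis integralBasis
  have : Module.Finite ℤ GaussianInt := .of_basis integralBasis
  have hcard := Ideal.absNorm_span_singleton z
  rw [Ideal.absNorm_apply, Submodule.cardQuot_apply, algebraNorm_eq_norm] at hcard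
  rw [hcard, Int.natAbs_of_nonneg (GaussianInt.norm_nonneg z), ← Zsqrtd.norm_eq_mul_conj]
  simp

/-- Nonzero elements of `ℤ[i]` correspond to pairs of a unit and a nonzero ideal. -/
theorem bijective_units_mul_generator : Function.Bijective
    fun p : GaussianIntˣ × {I : Ideal GaussianInt // I ≠ ⊥} ↦
      (⟨p.1 * Submodule.IsPrincipal.generator p.2.1, mul_ne_zero p.1.ne_zero
        fun h ↦ p.2.2 ((Submodule.IsPrincipal.eq_bot_iff_generator_eq_zero _).2 h)⟩ :
        {z : GaussianInt // z ≠ 0}) := by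
  constructor
  · rintro ⟨u, I, hI⟩ ⟨v, J, hJ⟩ h
    have hval : (u : GaussianInt) * Submodule.IsPrincipal.generator I =
        v * Submodule.IsPrincipal.generator J := congrArg Subtype.val h
    have hIJ : I = J := by
      have := congrArg (fun z ↦ Ideal.span {z}) hval
      simpa [Ideal.span_singleton_mul_left_unit] using this
    subst hIJ
    have hgen : Submodule.IsPrincipal.generator I ≠ 0 :=
      fun h ↦ hI ((Submodule.IsPrincipal.eq_bot_iff_generator_eq_zero _).2 h)
    rw [Units.ext (mul_right_cancel₀ hgen hval)]
  · rintro ⟨z, hz⟩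
    obtain ⟨u, hu⟩ := (Ideal.span_singleton_eq_span_singleton.1
      (Ideal.span_singleton_generator (Ideal.span {z})))
    exact ⟨(u, ⟨Ideal.span {z}, by simpa using hz⟩), Subtype.ext ((mul_comm _ _).trans hu)⟩

end GaussianInt

/-- Summing a function that ignores a finite nonempty factor multiplies the sum by the size of
that factor, whether or not the sum converges. -/
theorem tsum_prod_comp_snd {α β : Type*} [Finite α] [Nonempty α] (f : β → ℂ) :
    ∑' p : α × β, f p.2 = Nat.card α * ∑' b, f b := by
  have := Fintype.ofFinite α
  by_cases hf : Summable f
  · have hsum : Summable fun p : α × β ↦ f p.2 := by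
      have h := summable_mul_of_summable_norm (f := fun _ : α ↦ (1 : ℂ)) .of_finite hf.norm
      simpa only [one_mul] using h
    rw [hsum.tsum_prod]
    simp [Nat.card_eq_fintype_card]
  · have hnot : ¬ Summable fun p : α × β ↦ f p.2 := fun h ↦
      hf (h.comp_injective (Prod.mk_right_injective (Classical.arbitrary α)))
    rw [tsum_eq_zero_of_not_summable hf, tsum_eq_zero_of_not_summable hnot, mul_zero]

/-- For `Re s > 1`, the Dedekind zeta function of `ℚ(i)` — the sum of `N(𝔞)⁻ˢ` over
all nonzero integral ideals `𝔞` of the ring of Gaussian integers `ℤ[i]`, where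
`N(𝔞)` is the absolute ideal norm, i.e. the cardinality of the quotient ring —
equals `(1/4) · Σ_{ν ∈ ℤ[i], ν ≠ 0} (ν·conj ν)⁻ˢ`. -/
theorem dedekindZeta_gaussian (s : ℂ) (hs : 1 < s.re) :
    ∑' I : {I : Ideal GaussianInt // I ≠ ⊥}, ((Nat.card (GaussianInt ⧸ I.1) : ℂ)) ^ (-s) =
      (1 / 4) * ∑' ν : {ν : GaussianInt // ν ≠ 0}, (((ν.1 * star ν.1).re : ℂ)) ^ (-s) := by
  have : Finite GaussianIntˣ := Nat.finite_of_card_ne_zero (by simp [GaussianInt.card_units])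
  rw [← (Equiv.ofBijective _ GaussianInt.bijective_units_mul_generator).tsum_eq]
  have hterm (p : GaussianIntˣ × {I : Ideal GaussianInt // I ≠ ⊥}) :
      (((p.1 * Submodule.IsPrincipal.generator p.2.1 *
        star (p.1 * Submodule.IsPrincipal.generator p.2.1 : GaussianInt)).re : ℤ) : ℂ) =
      Nat.card (GaussianInt ⧸ p.2.1) := by
    rw [← GaussianInt.card_quotient_span_singleton,
      Ideal.span_singleton_mul_left_unit p.1.isUnit, Ideal.span_singleton_generator,
      Int.cast_natCast]
  simp only [Equiv.ofBijective_apply, hterm]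
  rw [tsum_prod_comp_snd (α := GaussianIntˣ)
    fun I : {I : Ideal GaussianInt // I ≠ ⊥} ↦ (Nat.card (GaussianInt ⧸ I.1) : ℂ) ^ (-s),
    GaussianInt.card_units]
  push_cast
  ring
end

section
/- The hyperbolic area of the fundamental domain of the modular group is π/3: the integral of 1/y² with respect to two-dimensional Lebesgue measure over the region F = {(x, y) ∈ ℝ² : -1/2 < x < 1/2, x² + y² > 1, y > 0} equals π/3. -/
open MeasureTheory

/-- The improper integral of `1 / y ^ 2` over `(a, ∞)` is `1 / a`. -/
theorem lintegral_Ioi_one_div_sq {a : ℝ} (ha : 0 < a) :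
    ∫⁻ y in Set.Ioi a, ENNReal.ofReal (1 / y ^ 2) = ENNReal.ofReal (1 / a) := by
  have hpow : Set.EqOn (fun y : ℝ => y ^ (-2 : ℝ)) (fun y => 1 / y ^ 2) (Set.Ioi a) := by
    intro y hy
    have hy0 : 0 ≤ y := (ha.trans hy).le
    simp [Real.rpow_neg hy0]
  have hint : IntegrableOn (fun y : ℝ => 1 / y ^ 2) (Set.Ioi a) :=
    (integrableOn_Ioi_rpow_of_lt (by norm_num) ha).congr_fun hpow measurableSet_Ioi
  rw [← ofReal_integral_eq_lintegral_ofReal hint (ae_of_all _ fun y => by positivity),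
    ← setIntegral_congr_fun measurableSet_Ioi hpow, integral_Ioi_rpow_of_lt (by norm_num) ha]
  norm_num [Real.rpow_neg_one]

/-- The integral of `1 / √(1 - x ^ 2)` over `(-1/2, 1/2)` is `π / 3`. -/
theorem lintegral_Ioo_one_div_sqrt_one_sub_sq :
    ∫⁻ x in Set.Ioo (-(1 / 2) : ℝ) (1 / 2), ENNReal.ofReal (1 / √(1 - x ^ 2)) =
      ENNReal.ofReal (Real.pi / 3) := by
  have huIcc : Set.uIcc (-(1 / 2) : ℝ) (1 / 2) = Set.Icc (-(1 / 2)) (1 / 2) :=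
    Set.uIcc_of_le (by norm_num)
  have hcont : ContinuousOn (fun x : ℝ => 1 / √(1 - x ^ 2)) (Set.uIcc (-(1 / 2)) (1 / 2)) := by
    rw [huIcc]
    refine continuousOn_const.div (by fun_prop) fun x hx => ?_
    exact (Real.sqrt_pos.2 (by nlinarith [hx.1, hx.2])).ne'
  have hint := hcont.intervalIntegrable (μ := volume)
  have harcsin : Real.arcsin (1 / 2) = Real.pi / 6 :=
    Real.arcsin_eq_of_sin_eq Real.sin_pi_div_six
      ⟨by linarith [Real.pi_pos], by linarith [Real.pi_pos]⟩
  have hval : ∫ x in (-(1 / 2) : ℝ)..(1 / 2), 1 / √(1 - x ^ 2) = Real.pi / 3 := by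
    rw [intervalIntegral.integral_eq_sub_of_hasDerivAt (f := Real.arcsin) _ hint,
      Real.arcsin_neg, harcsin]
    · ring
    · intro x hx
      rw [huIcc] at hx
      exact Real.hasDerivAt_arcsin (by linarith [hx.1]) (by linarith [hx.2])
  rw [setLIntegral_congr Ioo_ae_eq_Ioc,
    ← ofReal_integral_eq_lintegral_ofReal
      ((intervalIntegrable_iff_integrableOn_Ioc_of_le (by norm_num)).1 hint)
      (ae_of_all _ fun x => by positivity),
    ← intervalIntegral.integral_of_le (by norm_num), hval]

/-- The hyperbolic area of the fundamental domain of the modular group: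
the integral of `1/y²` over `F = {(x,y) : -1/2 < x < 1/2, x² + y² > 1, y > 0}`
equals `π/3`. -/
theorem modular_fundamental_domain_area :
    (∫ p in {p : ℝ × ℝ | -(1/2) < p.1 ∧ p.1 < 1/2 ∧ 1 < p.1 ^ 2 + p.2 ^ 2 ∧ 0 < p.2},
        1 / p.2 ^ 2) = Real.pi / 3 := by
  set F : Set (ℝ × ℝ) :=
    {p : ℝ × ℝ | -(1/2) < p.1 ∧ p.1 < 1/2 ∧ 1 < p.1 ^ 2 + p.2 ^ 2 ∧ 0 < p.2} with hF
  have hmeas : MeasurableSet F := by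
    rw [hF]
    measurability
  have hdensity : Measurable fun p : ℝ × ℝ => ENNReal.ofReal (1 / p.2 ^ 2) := by fun_prop
  rw [integral_eq_lintegral_of_nonneg_ae (ae_of_all _ fun p => by positivity)
    (Measurable.aestronglyMeasurable (by fun_prop))]
  suffices h : ∫⁻ p in F, ENNReal.ofReal (1 / p.2 ^ 2) = ENNReal.ofReal (Real.pi / 3) by
    rw [h, ENNReal.toReal_ofReal (by positivity)]
  rw [← lintegral_indicator hmeas, Measure.volume_eq_prod,
    lintegral_prod _ (hdensity.indicator hmeas).aemeasurable,
    ← lintegral_Ioo_one_div_sqrt_one_sub_sq, ← lintegral_indicator measurableSet_Ioo]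
  refine lintegral_congr fun x => ?_
  by_cases hx : x ∈ Set.Ioo (-(1 / 2) : ℝ) (1 / 2)
  · have hpos : 0 < 1 - x ^ 2 := by nlinarith [hx.1, hx.2]
    rw [Set.indicator_of_mem hx, ← lintegral_Ioi_one_div_sq (Real.sqrt_pos.2 hpos),
      ← lintegral_indicator measurableSet_Ioi]
    refine lintegral_congr fun y => ?_
    have hmem : (x, y) ∈ F ↔ y ∈ Set.Ioi √(1 - x ^ 2) := by
      constructor
      · rintro ⟨-, -, h, hy⟩
        exact (Real.sqrt_lt' hy).2 (by linarith)
      · intro h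
        have hy : 0 < y := (Real.sqrt_nonneg _).trans_lt h
        have := (Real.sqrt_lt' hy).1 h
        exact ⟨hx.1, hx.2, by linarith, hy⟩
    simp only [Set.indicator_apply, hmem]
  · have hslice (y : ℝ) : (x, y) ∉ F := fun h => hx ⟨h.1, h.2.1⟩
    rw [Set.indicator_of_notMem hx]
    simp [hslice]
end

section
/- For every real r, the I-Bessel function of imaginary order ir satisfies the asymptotic relation I_{ir}(x) ~ √(1/(2πx)) · e^{x} as x → ∞; i.e., the complex number I_{ir}(x) / (√(1/(2πx)) e^{x}) tends to 1 as x → ∞. -/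
open Filter

/-- The I-Bessel function of imaginary order `ir` (`r` real), defined for real `x`
by `I_{ir}(x) = (x/2)^{ir} · Σ_{k=0}^∞ (x/2)^{2k} / (k! · Γ(ir + k + 1))`, where
`(x/2)^{ir} = exp(ir·log(x/2))` with the real logarithm and `Γ` is the complex
Gamma function. -/
noncomputable def besselI (r : ℝ) (x : ℝ) : ℂ :=
  Complex.exp (Complex.I * r * Real.log (x / 2)) *
    ∑' k : ℕ, ((x : ℂ) / 2) ^ (2 * k) /
      ((k.factorial : ℂ) * Complex.Gamma (Complex.I * r + k + 1))

open MeasureTheory Set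

/-- `Γ(k + 1/2) = (2k)! Γ(1/2) / (4^k k!)`, stated without division. -/
theorem Gamma_nat_add_half_mul (k : ℕ) :
    Complex.Gamma (k + 1 / 2) * (4 ^ k * k.factorial) =
      (2 * k).factorial * Complex.Gamma (1 / 2) := by
  induction k with
  | zero => simp
  | succ k ih =>
    have hk : (k + 1 / 2 : ℂ) ≠ 0 := by
      intro h
      have := congrArg Complex.re h
      have hre : (k + 1 / 2 : ℂ).re = k + 1 / 2 := by simp
      rw [hre, Complex.zero_re] at this
      linarith [(k.cast_nonneg : (0 : ℝ) ≤ k)]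
    have h2 : 2 * (k + 1) = 2 * k + 1 + 1 := by ring
    rw [show ((k + 1 : ℕ) : ℂ) + 1 / 2 = (k + 1 / 2) + 1 by push_cast; ring,
      Complex.Gamma_add_one _ hk, h2, Nat.factorial_succ, Nat.factorial_succ, Nat.factorial_succ]
    push_cast
    linear_combination (k + 1 / 2) * 4 * (k + 1) * ih

/-- The Poisson integral representation of the series of `I_ν`, for `Re ν > -1/2`. -/
theorem hasSum_besselI_poisson {ν : ℂ} (hν : -1 / 2 < ν.re) (x : ℝ) :
    HasSum (fun k : ℕ => Complex.Gamma (1 / 2) * Complex.Gamma (ν + 1 / 2) *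
        (((x : ℂ) / 2) ^ (2 * k) / (k.factorial * Complex.Gamma (ν + k + 1))))
      (∫ s in Ioc (0 : ℝ) 1, (Real.cosh (x * √s) : ℂ) *
        ((s : ℂ) ^ (1 / 2 - 1 : ℂ) * (1 - s : ℂ) ^ (ν + 1 / 2 - 1))) := by
  have hν' : 0 < (ν + 1 / 2).re := by
    have : (ν + 1 / 2).re = ν.re + 1 / 2 := by simp
    linarith
  have hhalf (k : ℕ) : 0 < ((k : ℂ) + 1 / 2).re := by
    have : ((k : ℂ) + 1 / 2).re = k + 1 / 2 := by simp
    rw [this]; positivity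
  let F : ℕ → ℝ → ℂ := fun k s => ((x ^ (2 * k) / (2 * k).factorial : ℝ) : ℂ) *
    ((s : ℂ) ^ ((k + 1 / 2) - 1 : ℂ) * (1 - s : ℂ) ^ (ν + 1 / 2 - 1))
  have hbeta (k : ℕ) : IntegrableOn (fun s : ℝ =>
      (s : ℂ) ^ ((k + 1 / 2) - 1 : ℂ) * (1 - s : ℂ) ^ (ν + 1 / 2 - 1)) (Ioc 0 1) :=
    (intervalIntegrable_iff_integrableOn_Ioc_of_le zero_le_one).1
      (Complex.betaIntegral_convergent (hhalf k) hν')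
  have hpow (k : ℕ) {s : ℝ} (hs : 0 < s) :
      (s : ℂ) ^ ((k + 1 / 2) - 1 : ℂ) = (s ^ k : ℝ) * (s : ℂ) ^ (1 / 2 - 1 : ℂ) := by
    rw [add_sub_assoc, Complex.cpow_add _ _ (by exact_mod_cast hs.ne'), Complex.cpow_natCast]
    push_cast; rfl
  have hbeta0 : IntegrableOn (fun s : ℝ =>
      (s : ℂ) ^ (1 / 2 - 1 : ℂ) * (1 - s : ℂ) ^ (ν + 1 / 2 - 1)) (Ioc 0 1) := by
    simpa using hbeta 0
  have hint (k : ℕ) : Integrable (F k) (volume.restrict (Ioc 0 1)) := (hbeta k).const_mul _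
  have hcosh : Summable fun k : ℕ => |x| ^ (2 * k) / (2 * k).factorial :=
    (Real.hasSum_cosh |x|).summable
  have hsum : Summable fun k => ∫ s in Ioc (0 : ℝ) 1, ‖F k s‖ := by
    refine Summable.of_nonneg_of_le (fun k => integral_nonneg fun s => norm_nonneg _)
      (fun k => ?_) (hcosh.mul_right (∫ s in Ioc (0 : ℝ) 1,
        ‖(s : ℂ) ^ (1 / 2 - 1 : ℂ) * (1 - s : ℂ) ^ (ν + 1 / 2 - 1)‖))
    rw [← integral_const_mul]
    refine setIntegral_mono_on (hint k).norm (hbeta0.norm.const_mul _) measurableSet_Ioc ?_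
    intro s hs
    simp only [F]
    rw [hpow k hs.1, norm_mul, mul_assoc, norm_mul ((s ^ k : ℝ) : ℂ), Complex.norm_real,
      Complex.norm_real, norm_div, norm_pow, Real.norm_eq_abs, Real.norm_natCast]
    refine mul_le_mul_of_nonneg_left ?_ (by positivity)
    refine mul_le_of_le_one_left (norm_nonneg _) ?_
    rw [Real.norm_of_nonneg (pow_nonneg hs.1.le _)]
    exact pow_le_one₀ hs.1.le hs.2
  convert! hasSum_integral_of_summable_integral_norm hint hsum using 1
  · funext k
    simp only [F]
    rw [integral_const_mul, ← intervalIntegral.integral_of_le zero_le_one]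
    change _ = _ * Complex.betaIntegral (k + 1 / 2) (ν + 1 / 2)
    have hG := Complex.Gamma_mul_Gamma_eq_betaIntegral (hhalf k) hν'
    have hne : Complex.Gamma (ν + k + 1) ≠ 0 := by
      apply Complex.Gamma_ne_zero_of_re_pos
      have h1 : (ν + k + 1).re = ν.re + k + 1 := by simp
      have h2 : (0 : ℝ) ≤ k := k.cast_nonneg
      linarith
    rw [show (k + 1 / 2 + (ν + 1 / 2) : ℂ) = ν + k + 1 by ring] at hG
    have hk := Gamma_nat_add_half_mul k
    have h4 : ((x : ℂ) / 2) ^ (2 * k) * 4 ^ k = x ^ (2 * k) := by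
      rw [pow_mul, ← mul_pow, pow_mul]; congr 1; ring
    have hf : (k.factorial : ℂ) ≠ 0 := by exact_mod_cast k.factorial_ne_zero
    have hf2 : ((2 * k).factorial : ℂ) ≠ 0 := by exact_mod_cast (2 * k).factorial_ne_zero
    push_cast
    rw [← h4]
    generalize Complex.betaIntegral (k + 1 / 2) (ν + 1 / 2) = B at hG ⊢
    generalize Complex.Gamma (ν + 1 / 2) = G at hG ⊢
    generalize ((x : ℂ) / 2) ^ (2 * k) = y
    rw [mul_div_assoc', div_mul_eq_mul_div, div_eq_div_iff (mul_ne_zero hf hne) hf2]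
    linear_combination (-G) * y * hk + 4 ^ k * y * k.factorial * hG
  · refine setIntegral_congr_fun measurableSet_Ioc fun s hs => ?_
    refine (HasSum.tsum_eq ?_).symm
    have h := (Complex.hasSum_ofReal.2 (Real.hasSum_cosh (x * √s))).mul_right
      ((s : ℂ) ^ (1 / 2 - 1 : ℂ) * (1 - s : ℂ) ^ (ν + 1 / 2 - 1))
    convert! h using 1
    funext k
    simp only [F]
    rw [hpow k hs.1, mul_pow, pow_mul √s, Real.sq_sqrt hs.1.le]
    push_cast
    ring

/-- The substitution `s = (1 - u / x) ^ 2` in the Poisson integral. -/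
theorem integral_cosh_sqrt_mul_beta (ν : ℂ) {x : ℝ} (hx : 0 < x) :
    ∫ s in Ioc (0 : ℝ) 1, (Real.cosh (x * √s) : ℂ) *
        ((s : ℂ) ^ (1 / 2 - 1 : ℂ) * (1 - s : ℂ) ^ (ν + 1 / 2 - 1)) =
      2 * (x : ℂ) ^ (-(ν + 1 / 2)) * ∫ u in Ioo 0 x, (Real.cosh (x - u) : ℂ) *
        ((u : ℂ) ^ (ν + 1 / 2 - 1) * ((2 - u / x : ℝ) : ℂ) ^ (ν + 1 / 2 - 1)) := by
  have hdiv {u : ℝ} (hu : u ∈ Ioo 0 x) : 0 < 1 - u / x ∧ 0 < u / x :=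
    ⟨sub_pos.2 ((div_lt_one hx).2 hu.2), div_pos hu.1 hx⟩
  have himage : (fun u : ℝ => (1 - u / x) ^ 2) '' Ioo 0 x = Ioo 0 1 := by
    ext s
    constructor
    · rintro ⟨u, hu, rfl⟩
      obtain ⟨h1, h2⟩ := hdiv hu
      exact ⟨by positivity, pow_lt_one₀ h1.le (by linarith) two_ne_zero⟩
    · rintro ⟨h0, h1⟩
      have h2 : 0 < √s := Real.sqrt_pos.2 h0
      have h3 : √s < 1 := (Real.sqrt_lt' one_pos).2 (by simpa using h1)
      refine ⟨x * (1 - √s), ⟨mul_pos hx (by linarith), by nlinarith⟩, ?_⟩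
      simp only
      rw [mul_div_cancel_left₀ _ hx.ne', sub_sub_cancel, Real.sq_sqrt h0.le]
  have hderiv (u : ℝ) (_ : u ∈ Ioo 0 x) : HasDerivWithinAt (fun u : ℝ => (1 - u / x) ^ 2)
      (2 * (1 - u / x) * (-(1 / x))) (Ioo 0 x) u := by
    have h := ((((hasDerivAt_id u).div_const x).const_sub 1).pow 2).hasDerivWithinAt (s := Ioo 0 x)
    convert! h using 1
    simp
  have hinj : InjOn (fun u : ℝ => (1 - u / x) ^ 2) (Ioo 0 x) := by
    intro u hu v hv h
    have h1 := (pow_left_inj₀ (hdiv hu).1.le (hdiv hv).1.le two_ne_zero).1 h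
    field_simp at h1
    linarith
  rw [integral_Ioc_eq_integral_Ioo, ← himage,
    integral_image_eq_integral_abs_deriv_smul measurableSet_Ioo hderiv hinj, ← integral_const_mul]
  refine setIntegral_congr_fun measurableSet_Ioo fun u hu => ?_
  obtain ⟨h1, h2⟩ := hdiv hu
  have hne : ((1 - u / x : ℝ) : ℂ) ≠ 0 := by exact_mod_cast h1.ne'
  have hsqrt : (((1 - u / x) ^ 2 : ℝ) : ℂ) ^ (1 / 2 - 1 : ℂ) = ((1 - u / x : ℝ) : ℂ)⁻¹ := by
    rw [show (1 / 2 - 1 : ℂ) = ((-(1 / 2) : ℝ) : ℂ) by push_cast; ring,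
      ← Complex.ofReal_cpow (by positivity), ← Real.rpow_natCast, ← Real.rpow_mul h1.le,
      ← Complex.ofReal_inv, ← Real.rpow_neg_one]
    norm_num
  have hone : (1 - (((1 - u / x) ^ 2 : ℝ) : ℂ)) =
      ((u * x⁻¹ : ℝ) : ℂ) * ((2 - u / x : ℝ) : ℂ) := by
    push_cast; ring
  have hx' : (x : ℂ) ≠ 0 := by exact_mod_cast hx.ne'
  have hscale : (x : ℂ) ^ (-(ν + 1 / 2)) = (x : ℂ)⁻¹ * ((x⁻¹ : ℝ) : ℂ) ^ (ν + 1 / 2 - 1) := by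
    rw [Complex.ofReal_inv, Complex.inv_cpow_ofReal_nonneg hx.le, ← Complex.cpow_neg,
      ← Complex.cpow_neg_one, ← Complex.cpow_add _ _ hx']
    congr 1; ring
  have habs : |2 * (1 - u / x) * (-(1 / x))| = 2 * (1 - u / x) * (1 / x) := by
    rw [mul_neg, abs_neg, abs_of_pos (by positivity)]
  rw [habs, Real.sqrt_sq h1.le, hsqrt, hone,
    Complex.mul_cpow_ofReal_nonneg (by have := hu.1; positivity) (by linarith),
    Complex.ofReal_mul, Complex.mul_cpow_ofReal_nonneg hu.1.le (by positivity), hscale,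
    show x * (1 - u / x) = x - u by field_simp, Complex.real_smul]
  rw [Complex.ofReal_mul, Complex.ofReal_mul, Complex.ofReal_div, Complex.ofReal_one]
  generalize ((1 - u / x : ℝ) : ℂ) = w at hne
  generalize ((2 - u / x : ℝ) : ℂ) ^ (ν + 1 / 2 - 1) = a
  generalize ((x⁻¹ : ℝ) : ℂ) ^ (ν + 1 / 2 - 1) = b
  field_simp
  push_cast
  ring

/-- Laplace method for the Poisson integral: the endpoint `u = 0` dominates. -/
theorem tendsto_integral_exp_neg_mul_cosh {ν : ℂ} (hν : -1 / 2 < ν.re) (hν' : ν.re ≤ 1 / 2) :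
    Tendsto (fun x : ℝ => (Real.exp (-x) : ℂ) * ∫ u in Ioo 0 x, (Real.cosh (x - u) : ℂ) *
        ((u : ℂ) ^ (ν + 1 / 2 - 1) * ((2 - u / x : ℝ) : ℂ) ^ (ν + 1 / 2 - 1)))
      atTop (nhds (1 / 2 * 2 ^ (ν + 1 / 2 - 1) * Complex.Gamma (ν + 1 / 2))) := by
  have hre : (ν + 1 / 2).re = ν.re + 1 / 2 := by simp
  have hpos : 0 < (ν + 1 / 2).re := by linarith
  have hre' : (ν + 1 / 2 - 1).re ≤ 0 := by rw [Complex.sub_re, hre, Complex.one_re]; linarith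
  have hGamma := Complex.GammaIntegral_convergent hpos
  let f : ℝ → ℝ → ℂ := fun x => (Ioo 0 x).indicator fun u =>
    ((Real.exp (-x) * Real.cosh (x - u) : ℝ) : ℂ) *
      ((u : ℂ) ^ (ν + 1 / 2 - 1) * ((2 - u / x : ℝ) : ℂ) ^ (ν + 1 / 2 - 1))
  have hexp (x u : ℝ) : Real.exp (-x) * Real.cosh (x - u) =
      (Real.exp (-u) + Real.exp (u - 2 * x)) / 2 := by
    rw [Real.cosh_eq, mul_div_assoc', mul_add, ← Real.exp_add, ← Real.exp_add]
    ring_nf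
  have hlim : Tendsto (fun x => ∫ u in Ioi 0, f x u) atTop (nhds (∫ u in Ioi (0 : ℝ),
      1 / 2 * 2 ^ (ν + 1 / 2 - 1) * ((Real.exp (-u) : ℂ) * (u : ℂ) ^ (ν + 1 / 2 - 1)))) := by
    refine tendsto_integral_filter_of_dominated_convergence
      (fun u => ‖(Real.exp (-u) : ℂ) * (u : ℂ) ^ (ν + 1 / 2 - 1)‖) ?_ ?_ hGamma.norm ?_
    · refine Eventually.of_forall fun x => Measurable.aestronglyMeasurable ?_
      refine Measurable.indicator ?_ measurableSet_Ioo
      fun_prop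
    · refine Eventually.of_forall fun x => (ae_restrict_mem measurableSet_Ioi).mono fun u _ => ?_
      by_cases hux : u ∈ Ioo 0 x
      · simp only [f, indicator_of_mem hux]
        have hx : 0 < x := hux.1.trans hux.2
        have h1 : 1 ≤ 2 - u / x := by linarith [(div_le_one hx).2 hux.2.le]
        have h2 : ‖((2 - u / x : ℝ) : ℂ) ^ (ν + 1 / 2 - 1)‖ ≤ 1 := by
          rw [Complex.norm_cpow_eq_rpow_re_of_pos (by linarith)]
          exact Real.rpow_le_one_of_one_le_of_nonpos h1 hre'
        have h3 : Real.exp (-x) * Real.cosh (x - u) ≤ Real.exp (-u) := by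
          have : Real.exp (u - 2 * x) ≤ Real.exp (-u) := Real.exp_le_exp.2 (by linarith [hux.2])
          rw [hexp]; linarith
        have h4 : 0 ≤ Real.exp (-x) * Real.cosh (x - u) := by
          rw [hexp]; positivity
        rw [norm_mul, norm_mul, norm_mul, Complex.norm_real, Complex.norm_real,
          Real.norm_of_nonneg h4, Real.norm_of_nonneg (Real.exp_pos _).le]
        exact mul_le_mul h3 (mul_le_of_le_one_right (norm_nonneg _) h2) (by positivity)
          (Real.exp_pos _).le
      · simp only [f, indicator_of_notMem hux, norm_zero]
        exact norm_nonneg _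
    · refine (ae_restrict_mem measurableSet_Ioi).mono fun u hu => ?_
      have hu : 0 < u := hu
      have hlim_exp : Tendsto (fun x => Real.exp (-x) * Real.cosh (x - u)) atTop
          (nhds (Real.exp (-u) / 2)) := by
        simp_rw [hexp]
        have h : Tendsto (fun x : ℝ => u - 2 * x) atTop atBot :=
          by
          simpa [sub_eq_add_neg] using tendsto_atBot_add_const_left atTop u
            (tendsto_neg_atTop_atBot.comp (tendsto_id.const_mul_atTop (two_pos (α := ℝ))))
        simpa using ((Real.tendsto_exp_atBot.comp h).const_add (Real.exp (-u))).div_const 2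
      have hlim_base : Tendsto (fun x : ℝ => ((2 - u / x : ℝ) : ℂ) ^ (ν + 1 / 2 - 1)) atTop
          (nhds (2 ^ (ν + 1 / 2 - 1))) := by
        have h : Tendsto (fun x : ℝ => 2 - u / x) atTop (nhds 2) := by
          simpa using (tendsto_id.const_div_atTop u).const_sub 2
        have h' := (Complex.continuous_ofReal.tendsto 2).comp h
        exact h'.cpow tendsto_const_nhds (by simp)
      have h := ((Complex.continuous_ofReal.tendsto _).comp hlim_exp).mul
        (hlim_base.const_mul ((u : ℂ) ^ (ν + 1 / 2 - 1)))
      refine (h.congr' ?_).trans_eq ?_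
      · filter_upwards [eventually_gt_atTop u] with x hx
        simp only [f, indicator_of_mem (show u ∈ Ioo 0 x from ⟨hu, hx⟩), Function.comp_apply]
      · congr 1; push_cast; ring
  rw [integral_const_mul] at hlim
  rw [Complex.Gamma_eq_integral hpos]
  refine hlim.congr fun x => ?_
  simp only [f]
  rw [setIntegral_indicator measurableSet_Ioo, inter_eq_self_of_subset_right Ioo_subset_Ioi_self,
    ← integral_const_mul]
  congr 1
  funext u
  push_cast
  ring

/-- For every real `r`, `I_{ir}(x) ~ √(1/(2πx)) · e^{x}` as `x → ∞`:
the ratio `I_{ir}(x) / (√(1/(2πx)) e^{x})` tends to `1`. -/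
theorem besselI_asymptotic (r : ℝ) :
    Tendsto (fun x : ℝ => besselI r x /
        ((Real.sqrt (1 / (2 * Real.pi * x)) * Real.exp x : ℝ) : ℂ))
      atTop (nhds 1) := by
  have hre : (Complex.I * r).re = 0 := by simp
  have hν : -1 / 2 < (Complex.I * r).re := by rw [hre]; norm_num
  have hG : Complex.Gamma (Complex.I * r + 1 / 2) ≠ 0 :=
    Complex.Gamma_ne_zero_of_re_pos (by simp)
  have hlim := (tendsto_integral_exp_neg_mul_cosh hν (by rw [hre]; norm_num)).const_mul
    (2 * (2 ^ (Complex.I * r + 1 / 2 - 1) * Complex.Gamma (Complex.I * r + 1 / 2))⁻¹)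
  have h2 : (2 : ℂ) ^ (Complex.I * r + 1 / 2 - 1) ≠ 0 := by simp [Complex.cpow_eq_zero_iff]
  refine (hlim.congr' ?_).trans_eq ?_
  swap
  · congr 1
    generalize Complex.Gamma (Complex.I * r + 1 / 2) = G at hG
    generalize (2 : ℂ) ^ (Complex.I * r + 1 / 2 - 1) = A at h2
    field_simp
  filter_upwards [eventually_gt_atTop 0] with x hx
  have hsum := (hasSum_besselI_poisson hν x).tsum_eq
  rw [tsum_mul_left, integral_cosh_sqrt_mul_beta _ hx] at hsum
  have hhalf : Complex.Gamma (1 / 2) = (√Real.pi : ℂ) := by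
    rw [← Real.Gamma_one_half_eq, ← Complex.Gamma_ofReal]
    norm_num
  have hpi : (√Real.pi : ℂ) ≠ 0 := by
    exact_mod_cast (Real.sqrt_pos.2 Real.pi_pos).ne'
  set J := ∫ u in Ioo 0 x, (Real.cosh (x - u) : ℂ) *
        ((u : ℂ) ^ (Complex.I * r + 1 / 2 - 1) *
          ((2 - u / x : ℝ) : ℂ) ^ (Complex.I * r + 1 / 2 - 1))
  have hx' : (x : ℂ) ≠ 0 := by exact_mod_cast hx.ne'
  have hpref : Complex.exp (Complex.I * r * Real.log (x / 2)) =
      (x : ℂ) ^ (Complex.I * r) / 2 ^ (Complex.I * r) := by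
    rw [Complex.cpow_def_of_ne_zero hx', Complex.cpow_def_of_ne_zero two_ne_zero,
      ← Complex.exp_sub, Real.log_div hx.ne' two_ne_zero]
    congr 1
    push_cast [Complex.ofReal_log hx.le, Complex.ofReal_log zero_le_two]
    ring
  have hsqrt {y : ℝ} (hy : 0 < y) : (y : ℂ) ^ (1 / 2 : ℂ) = (√y : ℂ) := by
    rw [Real.sqrt_eq_rpow, Complex.ofReal_cpow hy.le]
    norm_num
  have hxpow : (x : ℂ) ^ (-(Complex.I * r + 1 / 2)) =
      ((x : ℂ) ^ (Complex.I * r) * (√x : ℂ))⁻¹ := by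
    rw [Complex.cpow_neg, Complex.cpow_add _ _ hx', hsqrt hx]
  have htwo : (2 : ℂ) ^ (Complex.I * r + 1 / 2 - 1) = 2 ^ (Complex.I * r) / (√2 : ℂ) := by
    rw [show Complex.I * r + 1 / 2 - 1 = Complex.I * r - 1 / 2 by ring,
      Complex.cpow_sub _ _ two_ne_zero]
    exact_mod_cast congrArg ((2 : ℂ) ^ (Complex.I * r) / ·) (hsqrt two_pos)
  have hroot : √(1 / (2 * Real.pi * x)) = (√2 * √Real.pi * √x)⁻¹ := by
    rw [one_div, Real.sqrt_inv, Real.sqrt_mul (by positivity), Real.sqrt_mul zero_le_two]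
  have hP : (x : ℂ) ^ (Complex.I * r) ≠ 0 := by simp [Complex.cpow_eq_zero_iff, hx']
  have hQ : (2 : ℂ) ^ (Complex.I * r) ≠ 0 := by simp [Complex.cpow_eq_zero_iff]
  have hsx : (√x : ℂ) ≠ 0 := by exact_mod_cast (Real.sqrt_pos.2 hx).ne'
  have hs2 : (√2 : ℂ) ≠ 0 := by exact_mod_cast (Real.sqrt_pos.2 two_pos).ne'
  have hexp : (Real.exp x : ℂ) ≠ 0 := by exact_mod_cast (Real.exp_pos x).ne'
  rw [besselI, hpref, htwo, hroot, Real.exp_neg]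
  rw [hhalf, hxpow] at hsum
  rw [Complex.ofReal_mul, Complex.ofReal_inv, Complex.ofReal_inv, Complex.ofReal_mul,
    Complex.ofReal_mul]
  generalize Complex.Gamma (Complex.I * r + 1 / 2) = G at hG hsum ⊢
  generalize (∑' k : ℕ, ((x : ℂ) / 2) ^ (2 * k) /
      ((k.factorial : ℂ) * Complex.Gamma (Complex.I * r + k + 1))) = S at hsum ⊢
  generalize (x : ℂ) ^ (Complex.I * r) = P at *
  generalize (2 : ℂ) ^ (Complex.I * r) = Q at *
  generalize (Real.exp x : ℂ) = e at *
  field_simp at hsum ⊢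
  linear_combination -hsum
end

section
/- Let r be real and β = β₀ + β₁·i a nonzero Gaussian integer. Then the function f(x₀, x₁, y) = y · K_{ir}(2π|β|y) · e^{2πi(β₀x₀ - β₁x₁)}, defined on ℝ² × (0,∞), satisfies the eigenvalue equation Δf + (r² + 1)f = 0, where Δ = y²(∂²/∂x₀² + ∂²/∂x₁² + ∂²/∂y²) - y·∂/∂y is the hyperbolic Laplacian of the upper half-space. -/
open GaussianInt

/-- The K-Bessel function of imaginary order `ir` (`r` real),
`K_{ir}(x) = ∫₀^∞ e^{-x cosh t} cos(rt) dt` for `x > 0`. -/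
noncomputable def besselK (r : ℝ) (x : ℝ) : ℝ :=
  ∫ t in Set.Ioi (0 : ℝ), Real.exp (-x * Real.cosh t) * Real.cos (r * t)

/-- The Fourier mode `f(x₀,x₁,y) = y · K_{ir}(2π|β|y) · e^{2πi(β₀x₀ - β₁x₁)}` of a
Maass waveform, for a Gaussian integer `β = β₀ + β₁·i`. -/
noncomputable def fourierMode (r : ℝ) (β : GaussianInt) (x₀ x₁ y : ℝ) : ℂ :=
  ((y * besselK r (2 * Real.pi * Real.sqrt ((β.re : ℝ) ^ 2 + (β.im : ℝ) ^ 2) * y) : ℝ) : ℂ) *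
    Complex.exp (2 * Real.pi * Complex.I * ((β.re : ℂ) * x₀ - (β.im : ℂ) * x₁))

open MeasureTheory Filter Topology Asymptotics

/-- The `n`-th moment `∫₀^∞ (cosh t)ⁿ e^{-x cosh t} cos(rt) dt`, which equals `(-1)ⁿ` times the
`n`-th derivative of `besselK r` at `x > 0`. -/
noncomputable def besselKMoment (r : ℝ) (n : ℕ) (x : ℝ) : ℝ :=
  ∫ t in Set.Ioi (0 : ℝ), Real.cosh t ^ n * Real.exp (-x * Real.cosh t) * Real.cos (r * t)

lemma besselKMoment_zero (r : ℝ) : besselKMoment r 0 = besselK r := by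
  funext x
  simp [besselKMoment, besselK]

lemma tendsto_cosh_atTop : Tendsto Real.cosh atTop atTop :=
  tendsto_atTop_mono' _ ((eventually_ge_atTop 0).mono fun t ht =>
    (Real.self_le_sinh_iff.2 ht).trans (Real.sinh_lt_cosh t).le) tendsto_id

lemma integrableOn_cosh_pow_mul_exp {a : ℝ} (ha : 0 < a) (n : ℕ) :
    IntegrableOn (fun t => Real.cosh t ^ n * Real.exp (-a * Real.cosh t)) (Set.Ioi 0) := by
  refine integrable_of_isBigO_exp_neg (half_pos ha) (by fun_prop) ?_
  have hpow : (fun t => Real.cosh t ^ n) =O[atTop] fun t => Real.exp (a / 2 * Real.cosh t) :=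
    ((isLittleO_pow_exp_pos_mul_atTop n (half_pos ha)).comp_tendsto tendsto_cosh_atTop).isBigO
  refine (hpow.mul (isBigO_refl (fun t => Real.exp (-a * Real.cosh t)) _)).trans ?_
  refine IsBigO.of_bound 1 ((eventually_ge_atTop 0).mono fun t ht => ?_)
  have hle : t ≤ Real.cosh t := (Real.self_le_sinh_iff.2 ht).trans (Real.sinh_lt_cosh t).le
  rw [← Real.exp_add, Real.norm_eq_abs, Real.norm_eq_abs, Real.abs_exp, Real.abs_exp, one_mul,
    Real.exp_le_exp]
  nlinarith

lemma integrableOn_besselKMoment (r : ℝ) (n : ℕ) {x : ℝ} (hx : 0 < x) :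
    IntegrableOn (fun t => Real.cosh t ^ n * Real.exp (-x * Real.cosh t) * Real.cos (r * t))
      (Set.Ioi 0) := by
  refine (integrableOn_cosh_pow_mul_exp hx n).mono'
    (Continuous.aestronglyMeasurable (by fun_prop)) (ae_of_all _ fun t => ?_)
  have hc := Real.cosh_pos t
  rw [norm_mul, Real.norm_of_nonneg (by positivity : 0 ≤ Real.cosh t ^ n * _)]
  exact mul_le_of_le_one_right (by positivity) (Real.abs_cos_le_one _)

lemma hasDerivAt_besselKMoment (r : ℝ) (n : ℕ) {x : ℝ} (hx : 0 < x) :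
    HasDerivAt (besselKMoment r n) (-besselKMoment r (n + 1) x) x := by
  have key := (hasDerivAt_integral_of_dominated_loc_of_deriv_le
    (μ := volume.restrict (Set.Ioi (0 : ℝ))) (s := Set.Ioi (x / 2)) (x₀ := x)
    (F := fun x t => Real.cosh t ^ n * Real.exp (-x * Real.cosh t) * Real.cos (r * t))
    (F' := fun x t => -(Real.cosh t ^ (n + 1) * Real.exp (-x * Real.cosh t) * Real.cos (r * t)))
    (bound := fun t => Real.cosh t ^ (n + 1) * Real.exp (-(x / 2) * Real.cosh t))
    (Ioi_mem_nhds (half_lt_self hx))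
    (Eventually.of_forall fun z => Continuous.aestronglyMeasurable (by fun_prop))
    (integrableOn_besselKMoment r n hx)
    (Continuous.aestronglyMeasurable (by fun_prop))
    (ae_of_all _ fun t z hz => ?_)
    (integrableOn_cosh_pow_mul_exp (half_pos hx) (n + 1))
    (ae_of_all _ fun t z _ => ?_)).2
  · rwa [integral_neg] at key
  · have hc := Real.cosh_pos t
    have hz' : x / 2 < z := hz
    rw [norm_neg, norm_mul, Real.norm_of_nonneg (by positivity : 0 ≤ Real.cosh t ^ (n + 1) * _)]
    refine (mul_le_of_le_one_right (by positivity) (Real.abs_cos_le_one _)).trans ?_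
    gcongr
  · have h := ((((hasDerivAt_id z).neg.mul_const (Real.cosh t)).exp.const_mul
      (Real.cosh t ^ n)).mul_const (Real.cos (r * t)))
    refine h.congr_deriv ?_
    simp only [Pi.neg_apply, id_eq]
    ring

/-- The modified Bessel equation of order `ir`, in terms of moments. -/
lemma besselKMoment_ode (r : ℝ) {x : ℝ} (hx : 0 < x) :
    x ^ 2 * besselKMoment r 2 x - x * besselKMoment r 1 x
      + (r ^ 2 - x ^ 2) * besselKMoment r 0 x = 0 := by
  have i2 := (integrableOn_besselKMoment r 2 hx).const_mul (x ^ 2)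
  have i1 := (integrableOn_besselKMoment r 1 hx).const_mul x
  have i0 := (integrableOn_besselKMoment r 0 hx).const_mul (r ^ 2 - x ^ 2)
  have hderiv : ∀ t ∈ Set.Ici (0 : ℝ), HasDerivAt
      (fun t => Real.exp (-x * Real.cosh t) *
        (r * Real.sin (r * t) - x * Real.sinh t * Real.cos (r * t)))
      (x ^ 2 * (Real.cosh t ^ 2 * Real.exp (-x * Real.cosh t) * Real.cos (r * t))
        - x * (Real.cosh t ^ 1 * Real.exp (-x * Real.cosh t) * Real.cos (r * t))
        + (r ^ 2 - x ^ 2) *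
          (Real.cosh t ^ 0 * Real.exp (-x * Real.cosh t) * Real.cos (r * t))) t := by
    intro t _
    have hl : HasDerivAt (fun t : ℝ => r * t) r t := by
      simpa using (hasDerivAt_id t).const_mul r
    have h := ((Real.hasDerivAt_cosh t).const_mul (-x)).exp.mul
      ((hl.sin.const_mul r).sub (((Real.hasDerivAt_sinh t).const_mul x).mul hl.cos))
    refine h.congr_deriv ?_
    simp only [Pi.mul_apply, Pi.sub_apply]
    linear_combination (-x ^ 2 * Real.exp (-x * Real.cosh t) * Real.cos (r * t)) *
      Real.cosh_sq t
  have hlim : Tendsto (fun t => Real.exp (-x * Real.cosh t) *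
      (r * Real.sin (r * t) - x * Real.sinh t * Real.cos (r * t))) atTop (𝓝 0) := by
    have hu : Tendsto (fun u : ℝ => |r| * (u ^ 0 * Real.exp (-x * u))
        + x * (u ^ 1 * Real.exp (-x * u))) atTop (𝓝 0) := by
      have h (k : ℕ) : Tendsto (fun u : ℝ => u ^ k * Real.exp (-x * u)) atTop (𝓝 0) := by
        simpa using tendsto_rpow_mul_exp_neg_mul_atTop_nhds_zero k x hx
      simpa using ((h 0).const_mul |r|).add ((h 1).const_mul x)
    refine squeeze_zero_norm (fun t => ?_) (hu.comp tendsto_cosh_atTop)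
    have hs : |Real.sinh t| ≤ Real.cosh t := by
      rw [← Real.cosh_abs, Real.abs_sinh]
      exact (Real.sinh_lt_cosh _).le
    have h1 : |r * Real.sin (r * t)| ≤ |r| := by
      rw [abs_mul]
      exact mul_le_of_le_one_right (abs_nonneg _) (Real.abs_sin_le_one _)
    have h2 : |x * Real.sinh t * Real.cos (r * t)| ≤ x * Real.cosh t := by
      rw [abs_mul, abs_mul, abs_of_pos hx]
      exact (mul_le_of_le_one_right (by positivity) (Real.abs_cos_le_one _)).trans (by gcongr)
    rw [norm_mul, Real.norm_eq_abs, Real.abs_exp, Real.norm_eq_abs]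
    calc _ ≤ Real.exp (-x * Real.cosh t) * (|r| + x * Real.cosh t) := by
          gcongr
          exact (abs_sub _ _).trans (add_le_add h1 h2)
      _ = _ := by simp only [Function.comp_apply]; ring
  have h := integral_Ioi_of_hasDerivAt_of_tendsto' hderiv ((i2.sub i1).add i0) hlim
  have hadd := integral_add (i2.sub i1) i0
  simp only [Pi.sub_apply] at hadd
  rw [hadd, integral_sub i2 i1, integral_const_mul, integral_const_mul,
    integral_const_mul] at h
  simpa [besselKMoment] using h

lemma deriv_deriv_const_mul_cexp (A a b : ℂ) (x : ℝ) :
    deriv (deriv fun t : ℝ => A * Complex.exp (a * t + b)) x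
      = a ^ 2 * (A * Complex.exp (a * x + b)) := by
  have h (B : ℂ) : deriv (fun t : ℝ => B * Complex.exp (a * t + b))
      = fun t : ℝ => (B * a) * Complex.exp (a * t + b) := by
    funext t
    have hl : HasDerivAt (fun t : ℝ => a * (t : ℂ) + b) a t := by
      simpa using ((Complex.ofRealCLM.hasDerivAt (x := t)).const_mul a).add_const b
    rw [(hl.cexp.const_mul B).deriv]
    ring
  rw [h, h]
  ring

lemma hasDerivAt_besselKMoment_mul (r : ℝ) (n : ℕ) {c y : ℝ} (hc : 0 < c) (hy : 0 < y) :
    HasDerivAt (fun t => besselKMoment r n (c * t)) (-c * besselKMoment r (n + 1) (c * y)) y := by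
  have hl : HasDerivAt (fun t : ℝ => c * t) c y := by
    simpa using (hasDerivAt_id y).const_mul c
  exact ((hasDerivAt_besselKMoment r n (mul_pos hc hy)).comp y hl).congr_deriv (by ring)

lemma hasDerivAt_mul_besselK (r : ℝ) {c y : ℝ} (hc : 0 < c) (hy : 0 < y) :
    HasDerivAt (fun t => t * besselK r (c * t))
      (besselKMoment r 0 (c * y) - c * (y * besselKMoment r 1 (c * y))) y := by
  rw [← besselKMoment_zero]
  refine ((hasDerivAt_id y).mul (hasDerivAt_besselKMoment_mul r 0 hc hy)).congr_deriv ?_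
  simp only [id_eq]
  ring

lemma hasDerivAt_deriv_mul_besselK (r : ℝ) {c y : ℝ} (hc : 0 < c) (hy : 0 < y) :
    HasDerivAt (fun t => besselKMoment r 0 (c * t) - c * (t * besselKMoment r 1 (c * t)))
      (-2 * c * besselKMoment r 1 (c * y) + c ^ 2 * y * besselKMoment r 2 (c * y)) y := by
  refine ((hasDerivAt_besselKMoment_mul r 0 hc hy).sub
    (((hasDerivAt_id y).mul (hasDerivAt_besselKMoment_mul r 1 hc hy)).const_mul c)).congr_deriv ?_
  simp only [id_eq]
  ring

/-- For real `r` and a nonzero Gaussian integer `β`, the function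
`f(x₀,x₁,y) = y · K_{ir}(2π|β|y) · e^{2πi(β₀x₀ - β₁x₁)}` satisfies
`Δf + (r² + 1)f = 0` on the upper half-space, where
`Δ = y²(∂²/∂x₀² + ∂²/∂x₁² + ∂²/∂y²) - y·∂/∂y` is the hyperbolic Laplacian. -/
theorem fourierMode_is_laplace_eigenfunction (r : ℝ) (β : GaussianInt) (hβ : β ≠ 0) :
    ∀ x₀ x₁ y : ℝ, 0 < y →
      (y : ℂ) ^ 2 *
          (deriv (deriv (fun t => fourierMode r β t x₁ y)) x₀ +
           deriv (deriv (fun t => fourierMode r β x₀ t y)) x₁ +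
           deriv (deriv (fun t => fourierMode r β x₀ x₁ t)) y) -
        (y : ℂ) * deriv (fun t => fourierMode r β x₀ x₁ t) y +
        ((r : ℂ) ^ 2 + 1) * fourierMode r β x₀ x₁ y = 0 := by
  intro x₀ x₁ y hy
  set c : ℝ := 2 * Real.pi * Real.sqrt ((β.re : ℝ) ^ 2 + (β.im : ℝ) ^ 2) with hc_def
  have hnorm : 0 < (β.re : ℝ) ^ 2 + (β.im : ℝ) ^ 2 := by
    by_contra! h
    refine hβ (Zsqrtd.ext ?_ ?_)
    · have : (β.re : ℝ) = 0 := by nlinarith [sq_nonneg (β.re : ℝ), sq_nonneg (β.im : ℝ)]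
      exact_mod_cast this
    · have : (β.im : ℝ) = 0 := by nlinarith [sq_nonneg (β.re : ℝ), sq_nonneg (β.im : ℝ)]
      exact_mod_cast this
  have hc : 0 < c := by positivity
  have hc2 : c ^ 2 = 4 * Real.pi ^ 2 * ((β.re : ℝ) ^ 2 + (β.im : ℝ) ^ 2) := by
    rw [hc_def, mul_pow, Real.sq_sqrt hnorm.le]
    ring
  have hx₀ : deriv (deriv (fun t => fourierMode r β t x₁ y)) x₀
      = (2 * Real.pi * Complex.I * β.re) ^ 2 * fourierMode r β x₀ x₁ y := by
    convert deriv_deriv_const_mul_cexp ((y * besselK r (c * y) : ℝ) : ℂ)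
      (2 * Real.pi * Complex.I * β.re) (-(2 * Real.pi * Complex.I * β.im * x₁)) x₀ using 4
    all_goals simp only [fourierMode, hc_def]; ring_nf
  have hx₁ : deriv (deriv (fun t => fourierMode r β x₀ t y)) x₁
      = (-(2 * Real.pi * Complex.I * β.im)) ^ 2 * fourierMode r β x₀ x₁ y := by
    convert deriv_deriv_const_mul_cexp ((y * besselK r (c * y) : ℝ) : ℂ)
      (-(2 * Real.pi * Complex.I * β.im)) (2 * Real.pi * Complex.I * β.re * x₀) x₁ using 4
    all_goals simp only [fourierMode, hc_def]; ring_nf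
  set E := Complex.exp (2 * Real.pi * Complex.I * ((β.re : ℂ) * x₀ - (β.im : ℂ) * x₁)) with hE
  have hy₁ : ∀ t : ℝ, 0 < t → deriv (fun t => fourierMode r β x₀ x₁ t) t
      = ((besselKMoment r 0 (c * t) - c * (t * besselKMoment r 1 (c * t)) : ℝ) : ℂ) * E :=
    fun t ht => ((hasDerivAt_mul_besselK r hc ht).ofReal_comp.mul_const E).deriv
  have hy₂ : deriv (deriv (fun t => fourierMode r β x₀ x₁ t)) y
      = ((-2 * c * besselKMoment r 1 (c * y) + c ^ 2 * y * besselKMoment r 2 (c * y) : ℝ) : ℂ)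
        * E := by
    rw [EventuallyEq.deriv_eq ((eventually_gt_nhds hy).mono hy₁)]
    exact ((hasDerivAt_deriv_mul_besselK r hc hy).ofReal_comp.mul_const E).deriv
  have hf : fourierMode r β x₀ x₁ y = ((y * besselKMoment r 0 (c * y) : ℝ) : ℂ) * E := by
    rw [besselKMoment_zero]
    rfl
  have hode := congrArg (Complex.ofReal) (besselKMoment_ode r (mul_pos hc hy))
  have hc2' := congrArg (Complex.ofReal) hc2
  rw [hx₀, hx₁, hy₂, hy₁ y hy, hf]
  push_cast at hode hc2' ⊢
  linear_combination (y * E : ℂ) * hode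
    + (y ^ 3 * besselKMoment r 0 (c * y) * E : ℂ) * hc2'
    + (y ^ 3 * besselKMoment r 0 (c * y) * E * 4 * Real.pi ^ 2 * (β.re ^ 2 + β.im ^ 2) : ℂ)
      * Complex.I_sq
end

section
/- The group SL(2, ℤ[i]) is generated by the three matrices [[1,1],[0,1]], [[1,i],[0,1]], and [[0,-1],[1,0]]; i.e., the subgroup of SL(2, ℤ[i]) generated by these three elements is all of SL(2, ℤ[i]). (Consequently the Picard group PSL(2, ℤ[i]) is generated by the cosets of these three elements, which act on the upper half-space as the two translations z ↦ z+1, z ↦ z+i and the inversion z ↦ -z⁻¹.) -/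
open GaussianInt

/-- The translation matrix `[[1,1],[0,1]]` in `SL(2,ℤ[i])`. -/
def matT : Matrix.SpecialLinearGroup (Fin 2) GaussianInt :=
  ⟨!![1, 1; 0, 1], by simp [Matrix.det_fin_two_of]⟩

/-- The translation matrix `[[1,i],[0,1]]` in `SL(2,ℤ[i])`. -/
def matTi : Matrix.SpecialLinearGroup (Fin 2) GaussianInt :=
  ⟨!![1, ⟨0, 1⟩; 0, 1], by simp [Matrix.det_fin_two_of]⟩

/-- The inversion matrix `[[0,-1],[1,0]]` in `SL(2,ℤ[i])`. -/
def matS : Matrix.SpecialLinearGroup (Fin 2) GaussianInt :=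
  ⟨!![0, -1; 1, 0], by norm_num [Matrix.det_fin_two_of]⟩

namespace Matrix.SpecialLinearGroup

section CommRing

variable {R : Type*} [CommRing R]

/-- The homomorphism sending `x` to the upper unipotent matrix `[[1,x],[0,1]]`. -/
def upperUnipotent : Multiplicative R →* SpecialLinearGroup (Fin 2) R where
  toFun x := ⟨!![1, x.toAdd; 0, 1], by simp [Matrix.det_fin_two_of]⟩
  map_one' := by ext i j; fin_cases i <;> fin_cases j <;> simp
  map_mul' x y := by
    refine Subtype.ext (Eq.trans ?_ (coe_mul _ _).symm)
    simp [add_comm]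

/-- The Weyl element `[[0,-1],[1,0]]`. -/
def weyl (R : Type*) [CommRing R] : SpecialLinearGroup (Fin 2) R :=
  ⟨!![0, -1; 1, 0], by simp [Matrix.det_fin_two_of]⟩

lemma coe_upperUnipotent (x : R) :
    (upperUnipotent (Multiplicative.ofAdd x) : Matrix (Fin 2) (Fin 2) R) = !![1, x; 0, 1] := rfl

lemma coe_weyl : (weyl R : Matrix (Fin 2) (Fin 2) R) = !![0, -1; 1, 0] := rfl

/-- An upper triangular matrix in `SL₂` as a word in upper unipotents and the Weyl element. -/
lemma eq_word_of_lower_left_eq_zero (g : SpecialLinearGroup (Fin 2) R) (hg : g 1 0 = 0) :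
    g = upperUnipotent (Multiplicative.ofAdd (g 0 0)) * weyl R *
      upperUnipotent (Multiplicative.ofAdd (g 1 1)) * (weyl R)⁻¹ *
      upperUnipotent (Multiplicative.ofAdd (g 0 0)) * weyl R *
      upperUnipotent (Multiplicative.ofAdd (g 1 1 * g 0 1)) := by
  have hdet : g 0 0 * g 1 1 = 1 := by
    have h := g.det_coe
    rwa [Matrix.det_fin_two, hg, mul_zero, sub_zero] at h
  apply Subtype.ext
  simp only [coe_mul, coe_inv, coe_upperUnipotent, coe_weyl, Matrix.adjugate_fin_two_of]
  rw [Matrix.eta_fin_two (g : Matrix (Fin 2) (Fin 2) R)]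
  ext i j
  fin_cases i <;> fin_cases j <;> simp [hg] <;> grind

end CommRing

/-- Over a Euclidean domain, `SL₂` is generated by the upper unipotents and the Weyl element. -/
lemma eq_top_of_upperUnipotent_mem_of_weyl_mem {R : Type*} [EuclideanDomain R]
    (H : Subgroup (SpecialLinearGroup (Fin 2) R))
    (hU : ∀ x : R, upperUnipotent (Multiplicative.ofAdd x) ∈ H) (hS : weyl R ∈ H) : H = ⊤ := by
  suffices key : ∀ (c : R) (g : SpecialLinearGroup (Fin 2) R), g 1 0 = c → g ∈ H from
    (Subgroup.eq_top_iff' H).2 fun g => key _ g rfl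
  intro c
  induction c using (EuclideanDomain.r_wellFounded (R := R)).induction with
  | _ c ih =>
    intro g hg
    by_cases hc : c = 0
    · rw [eq_word_of_lower_left_eq_zero g (hg.trans hc)]
      exact mul_mem (mul_mem (mul_mem (mul_mem (mul_mem (mul_mem (hU _) hS) (hU _))
        (inv_mem hS)) (hU _)) hS) (hU _)
    · have hstep : (weyl R * upperUnipotent (Multiplicative.ofAdd (-(g 0 0 / c))) * g) 1 0 =
          g 0 0 % c := by
        rw [EuclideanDomain.mod_eq_sub_mul_div]
        simp [coe_upperUnipotent, coe_weyl, Matrix.mul_apply, Fin.sum_univ_two, hg]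
        ring
      have hmem := ih _ (EuclideanDomain.mod_lt _ hc) _ hstep
      exact (H.mul_mem_cancel_left (mul_mem hS (hU _))).1 hmem

end Matrix.SpecialLinearGroup

open Matrix.SpecialLinearGroup in
lemma upperUnipotent_eq_matT_zpow_mul_matTi_zpow (x : GaussianInt) :
    upperUnipotent (Multiplicative.ofAdd x) = matT ^ x.re * matTi ^ x.im := by
  have hT : matT = upperUnipotent (Multiplicative.ofAdd 1) := rfl
  have hTi : matTi = upperUnipotent (Multiplicative.ofAdd ⟨0, 1⟩) := rfl
  rw [hT, hTi, ← MonoidHom.map_zpow, ← MonoidHom.map_zpow, ← MonoidHom.map_mul,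
    ← ofAdd_zsmul, ← ofAdd_zsmul, ← ofAdd_add]
  congr 2
  ext <;> simp

/-- `SL(2,ℤ[i])` is generated by the three matrices `[[1,1],[0,1]]`,
`[[1,i],[0,1]]` and `[[0,-1],[1,0]]` (whose cosets generate the Picard group
`PSL(2,ℤ[i])`, acting on the upper half-space as the translations `z ↦ z+1`,
`z ↦ z+i` and the inversion `z ↦ -z⁻¹`). -/
theorem SL2_gaussianInt_generated_by_three :
    Subgroup.closure ({matT, matTi, matS} :
      Set (Matrix.SpecialLinearGroup (Fin 2) GaussianInt)) = ⊤ := by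
  refine Matrix.SpecialLinearGroup.eq_top_of_upperUnipotent_mem_of_weyl_mem _ (fun x => ?_)
    (Subgroup.subset_closure (Or.inr (Or.inr rfl)))
  rw [upperUnipotent_eq_matT_zpow_mul_matTi_zpow]
  have hT : matT ∈ ({matT, matTi, matS} : Set _) := by simp
  have hTi : matTi ∈ ({matT, matTi, matS} : Set _) := by simp
  exact mul_mem (zpow_mem (Subgroup.subset_closure hT) _)
    (zpow_mem (Subgroup.subset_closure hTi) _)
end
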